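/- Let I_1,…,I_n be monomial ideals, where I_l is an ideal of T generated by monomials in the variables x_{l1},…,x_{lm_l} (disjoint groups of variables), and for each l let H^{(l)} be a minimal ℤ^{m_l}-graded free resolution of I_l over T_l = K[x_{l1},…,x_{lm_l}]. Then the tensor product complex ⊗_{l=1}^n H^{(l)} (over T) is a minimal ℤ^N-graded free T-resolution of the product ideal I_1I_2⋯I_n. -/

import Mathlib

open MvPolynomial

/-- An ideal generated by monomials. -/
def IsMonomialIdeal {K : Type} [Field K] {σ : Type} (J : Ideal (MvPolynomial σ K)) : Prop :=
  ∃ A : Set (σ →₀ ℕ),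
    J = Ideal.span ((fun b => (monomial b (1 : K) : MvPolynomial σ K)) '' A)

/-- `f` is a homogeneous element of the multigraded free module, sitting in the
basis position of multidegree `b1`, of multidegree `b2`; i.e. `f` is a scalar
multiple of the monomial `x^(b2 - b1)` (and `b1 ≤ b2` unless `f = 0`). -/
def IsHomogEntry (K : Type) [Field K] {τ : Type} [Fintype τ] [DecidableEq τ]
    (b1 b2 : τ → ℕ) (f : MvPolynomial τ K) : Prop :=
  ∃ coef : K,
    f = coef • (monomial (Finsupp.equivFunOnFinite.symm fun v => b2 v - b1 v) 1 :
      MvPolynomial τ K) ∧ (coef ≠ 0 → ∀ v, b1 v ≤ b2 v)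

/-- Basis index set, in homological degree `k`, of the tensor product complex
`H^{(1)} ⊗ ⋯ ⊗ H^{(n)}`: a summand `H^{(1)}_{c 1} ⊗ ⋯ ⊗ H^{(n)}_{c n}` with
`∑ c l = k`, together with a basis element of each tensor factor
(`rl l i` is the rank of `H^{(l)}_i`). -/
abbrev TensIdx {n : ℕ} (rl : Fin n → ℕ → ℕ) (k : ℕ) : Type :=
  Σ c : {c : Fin n → Fin (k + 1) // ∑ i, (c i : ℕ) = k},
    ∀ l, Fin (rl l (c.1 l))

/-- The basis index obtained from `⟨c, f⟩` by raising the homological degree of the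
`l`-th tensor factor by one and replacing its basis element by `d`. -/
def tensIdxSucc {n : ℕ} (rl : Fin n → ℕ → ℕ) {k : ℕ}
    (c : {c : Fin n → Fin (k + 1) // ∑ i, (c i : ℕ) = k}) (l : Fin n)
    (d : Fin (rl l ((c.1 l : ℕ) + 1))) (f : ∀ l', Fin (rl l' (c.1 l'))) :
    TensIdx rl (k + 1) :=
  ⟨⟨fun l' => if l' = l then (c.1 l).succ else (c.1 l').castSucc, by
      have hc := c.2
      have h : ∀ i : Fin n,
          (((if i = l then (c.1 l).succ else (c.1 i).castSucc) : Fin (k + 2)) : ℕ)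
            = (c.1 i : ℕ) + (if i = l then 1 else 0) := by
        intro i; by_cases h : i = l <;> simp [h]
      simp only [h, Finset.sum_add_distrib, Finset.sum_ite_eq', Finset.mem_univ,
        if_true, hc]⟩,
    fun l' =>
      if h : l' = l then Fin.cast (by subst h; simp) d
      else Fin.cast (by simp [h]) (f l')⟩

/-- The differential of the tensor product complex `H^{(1)} ⊗ ⋯ ⊗ H^{(n)}` over
`T = T_1 ⊗_K ⋯ ⊗_K T_n`, namely `∑_l ± id ⊗ ⋯ ⊗ d^{(l)} ⊗ ⋯ ⊗ id` with the usual
Koszul signs; the matrices `Ml l` of the differentials of `H^{(l)}` over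
`T_l = K[x_{l1}, …, x_{l m_l}]` are transported into `T` along the inclusion
`T_l ↪ T` of the `l`-th group of variables. -/
noncomputable def tensDiff {K : Type} [Field K] {n : ℕ} (mfam : Fin n → ℕ)
    (rl : Fin n → ℕ → ℕ)
    (Ml : ∀ l i, Matrix (Fin (rl l i)) (Fin (rl l (i + 1))) (MvPolynomial (Fin (mfam l)) K))
    (k : ℕ) (u : TensIdx rl (k + 1) → MvPolynomial ((i : Fin n) × Fin (mfam i)) K) :
    TensIdx rl k → MvPolynomial ((i : Fin n) × Fin (mfam i)) K := fun x =>
  ∑ l : Fin n,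
    (-1 : MvPolynomial ((i : Fin n) × Fin (mfam i)) K) ^
        (∑ l' ∈ Finset.univ.filter (fun l' => l' < l), (x.1.1 l' : ℕ)) *
      ∑ d : Fin (rl l ((x.1.1 l : ℕ) + 1)),
        (rename (Sigma.mk l) (Ml l (x.1.1 l) (x.2 l) d)) * u (tensIdxSucc rl x.1 l d x.2)

/-- The augmentation `(H^{(1)} ⊗ ⋯ ⊗ H^{(n)})_0 → T` induced by the augmentations
`H^{(l)}_0 → I_l ⊆ T_l`, `e_d ↦ g_l(d)`. -/
noncomputable def tensAug {K : Type} [Field K] {n : ℕ} (mfam : Fin n → ℕ)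
    (rl : Fin n → ℕ → ℕ)
    (gl : ∀ l, Fin (rl l 0) → MvPolynomial (Fin (mfam l)) K)
    (u : TensIdx rl 0 → MvPolynomial ((i : Fin n) × Fin (mfam i)) K) :
    MvPolynomial ((i : Fin n) × Fin (mfam i)) K :=
  ∑ x : TensIdx rl 0,
    (∏ l, rename (Sigma.mk l)
      (gl l (Fin.cast
        (by rw [Finset.sum_eq_zero_iff.mp x.1.2 l (Finset.mem_univ l)]) (x.2 l)))) * u x

section LinearAlgebra

variable {K : Type*} [Field K]

/-- Every linear map between vector spaces has a generalized inverse. -/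
lemma LinearMap.exists_generalizedInverse {V W : Type*} [AddCommGroup V] [Module K V]
    [AddCommGroup W] [Module K W] (f : V →ₗ[K] W) :
    ∃ g : W →ₗ[K] V, ∀ v, f (g (f v)) = f v := by
  obtain ⟨g₀, hg₀⟩ := f.rangeRestrict.exists_rightInverse_of_surjective f.range_rangeRestrict
  obtain ⟨g, hg⟩ := g₀.exists_extend
  refine ⟨g, fun v => ?_⟩
  have h₁ : g (f v) = g₀ (f.rangeRestrict v) := LinearMap.congr_fun hg (f.rangeRestrict v)
  rw [h₁]
  exact congrArg Subtype.val (LinearMap.congr_fun hg₀ (f.rangeRestrict v))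

/-- A differential `d` on a vector space whose homology is detected by `ε` is split by a
contracting homotopy `s`, up to a projection `σ ∘ ε`. -/
lemma exists_contracting_homotopy {V W : Type*} [AddCommGroup V] [Module K V]
    [AddCommGroup W] [Module K W] (d π : Module.End K V) (ε : V →ₗ[K] W)
    (hdd : d * d = 0) (hεd : ε ∘ₗ d = 0) (hdπ : d * π = 0) (hεπ : ε ∘ₗ π = ε)
    (hex : ∀ v, d v = 0 → ε v = 0 → ∃ w, d w = v) :
    ∃ (σ : W →ₗ[K] V) (s : Module.End K V),
      d ∘ₗ σ = 0 ∧ d * s + s * d = 1 - σ ∘ₗ ε := by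
  obtain ⟨σ₀, hσ₀⟩ := ε.exists_generalizedInverse
  obtain ⟨r, hr⟩ := LinearMap.exists_generalizedInverse d
  have hεπ' : ∀ v, ε (π v) = ε v := LinearMap.congr_fun hεπ
  have hdπ' : ∀ v, d (π v) = 0 := LinearMap.congr_fun hdπ
  have hεd' : ∀ v, ε (d v) = 0 := LinearMap.congr_fun hεd
  have hdd' : ∀ v, d (d v) = 0 := LinearMap.congr_fun hdd
  set p : Module.End K V := (π ∘ₗ σ₀) ∘ₗ ε with hp
  set r' : Module.End K V := (1 - p) * r with hr'
  have hdp : ∀ v, d (p v) = 0 := fun v => hdπ' _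
  have hpd : ∀ v, p (d v) = 0 := fun v => by simp [hp, hεd']
  have hεp : ∀ v, ε (p v) = ε v := fun v => by simp [hp, hεπ', hσ₀]
  have hpp : ∀ v, p (p v) = p v := fun v => by
    change π (σ₀ (ε (p v))) = _
    rw [hεp]; rfl
  have hr'd : ∀ v, d (r' (d v)) = d v := fun v => by simp [hr', hdp, hr]
  have hpr' : ∀ v, p (r' v) = 0 := fun v => by simp [hr', hpp]
  refine ⟨π ∘ₗ σ₀, r' * (1 - p) * (1 - r' * d), LinearMap.ext fun v => hdπ' _, ?_⟩
  ext v
  have h₁ : d (r' ((1 - p) (v - r' (d v)))) = (1 - p) (v - r' (d v)) := by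
    obtain ⟨w, hw⟩ := hex ((1 - p) (v - r' (d v)))
      (by simp [hdp, hr'd]) (by simp [hεp])
    rw [← hw, hr'd]
  have h₂ : r' ((1 - p) (d v - r' (d (d v)))) = r' (d v) := by simp [hdd', hpd]
  change d (r' ((1 - p) (v - r' (d v)))) + r' ((1 - p) (d v - r' (d (d v)))) = v - p v
  rw [h₁, h₂, LinearMap.sub_apply 1 p, Module.End.one_apply, map_sub, hpr']
  abel

variable {n : ℕ} {V : Fin n → Type*} [∀ l, AddCommGroup (V l)] [∀ l, Module K (V l)]

open PiTensorProduct TensorProduct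

lemma PiTensorProduct.map_add_map_eq_zero {a b : ∀ l, Module.End K (V l)} (i : Fin n)
    (hi : a i = -b i) (h : ∀ j, j ≠ i → a j = b j) :
    PiTensorProduct.map a + PiTensorProduct.map b = 0 := by
  have ha : a = Function.update b i (-b i) := by
    ext1 j
    rcases eq_or_ne j i with rfl | hj
    · simpa using hi
    · simpa [hj] using h j hj
  have hb := PiTensorProduct.map_update_add b i (-b i) (b i)
  rw [Function.update_eq_self, ← ha, neg_add_cancel] at hb
  rw [← hb]
  exact (PiTensorProduct.mapMultilinear K V V).map_update_zero b i

lemma PiTensorProduct.map_eq_zero_of_coord {W : Fin n → Type*} [∀ l, AddCommGroup (W l)]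
    [∀ l, Module K (W l)] {a : ∀ l, V l →ₗ[K] W l} (i : Fin n) (hi : a i = 0) :
    PiTensorProduct.map a = 0 :=
  (PiTensorProduct.mapMultilinear K V W).map_coord_zero i hi

/-- The family of operators acting as `a` before position `l`, as `b` at `l`, and as `c` after. -/
def threeWay (a b c : ∀ l, Module.End K (V l)) (l j : Fin n) : Module.End K (V j) :=
  if j < l then a j else if j = l then b j else c j

lemma threeWay_of_lt (a b c : ∀ l, Module.End K (V l)) {l j : Fin n} (h : j < l) :
    threeWay a b c l j = a j := by simp [threeWay, h]

lemma threeWay_self (a b c : ∀ l, Module.End K (V l)) (l : Fin n) :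
    threeWay a b c l l = b l := by simp [threeWay]

lemma threeWay_of_gt (a b c : ∀ l, Module.End K (V l)) {l j : Fin n} (h : l < j) :
    threeWay a b c l j = c j := by simp [threeWay, h.not_gt, h.ne']

/-- The Koszul-signed differential of a tensor product of complexes, with differentials `d`
and sign operators `τ`. -/
noncomputable def koszulDiff (τ d : ∀ l, Module.End K (V l)) : Module.End K (⨂[K] l, V l) :=
  ∑ l, PiTensorProduct.map (threeWay τ d 1 l)

lemma koszulDiff_mul_self {τ d : ∀ l, Module.End K (V l)} (hdd : ∀ l, d l * d l = 0)
    (hτd : ∀ l, τ l * d l = -(d l * τ l)) :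
    koszulDiff τ d * koszulDiff τ d = 0 := by
  have hlt : ∀ l m : Fin n, l < m →
      PiTensorProduct.map (threeWay τ d 1 l) * PiTensorProduct.map (threeWay τ d 1 m) +
      PiTensorProduct.map (threeWay τ d 1 m) * PiTensorProduct.map (threeWay τ d 1 l) = 0 := by
    intro l m hlm
    rw [← PiTensorProduct.map_mul, ← PiTensorProduct.map_mul]
    refine PiTensorProduct.map_add_map_eq_zero l ?_ fun j hj => ?_
    · rw [threeWay_self, threeWay_of_lt _ _ _ hlm, hτd, neg_neg]
    · rcases lt_or_gt_of_ne hj with h | h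
      · rw [threeWay_of_lt _ _ _ h, threeWay_of_lt _ _ _ (h.trans hlm)]
      · rw [threeWay_of_gt _ _ _ h, Pi.one_apply, one_mul, mul_one]
  have hself : ∀ l : Fin n,
      PiTensorProduct.map (threeWay τ d 1 l) * PiTensorProduct.map (threeWay τ d 1 l) = 0 := by
    intro l
    rw [← PiTensorProduct.map_mul]
    exact PiTensorProduct.map_eq_zero_of_coord l (by rw [threeWay_self, hdd])
  rw [koszulDiff, Finset.sum_mul_sum, ← Finset.sum_product']
  refine Finset.sum_involution (fun x _ => x.swap) (fun x _ => ?_) (fun x _ hx hxs => hx ?_)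
    (fun _ _ => Finset.mem_univ _) (fun x _ => x.swap_swap)
  · obtain ⟨a, b⟩ := x
    rcases lt_trichotomy a b with h | rfl | h
    · exact hlt _ _ h
    · exact (congrArg₂ _ (hself a) (hself a)).trans (add_zero 0)
    · rw [add_comm]; exact hlt _ _ h
  · rw [show x.2 = x.1 from congrArg Prod.fst hxs]
    exact hself x.1

/-- Contracting homotopies of the factors assemble to a contracting homotopy of the tensor
product. -/
lemma koszulDiff_homotopy {τ d s p : ∀ l, Module.End K (V l)} (hττ : ∀ l, τ l * τ l = 1)
    (hτd : ∀ l, τ l * d l = -(d l * τ l)) (hdp : ∀ l, d l * p l = 0)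
    (hpd : ∀ l, p l * d l = 0) (hs : ∀ l, d l * s l + s l * d l = 1 - p l) :
    koszulDiff τ d * (∑ l, PiTensorProduct.map (threeWay τ s p l)) +
      (∑ l, PiTensorProduct.map (threeWay τ s p l)) * koszulDiff τ d =
      1 - PiTensorProduct.map p := by
  have hne : ∀ l m : Fin n, m ≠ l →
      PiTensorProduct.map (threeWay τ d 1 m) * PiTensorProduct.map (threeWay τ s p l) +
      PiTensorProduct.map (threeWay τ s p l) * PiTensorProduct.map (threeWay τ d 1 m) = 0 := by
    intro l m hml
    rw [← PiTensorProduct.map_mul, ← PiTensorProduct.map_mul]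
    rcases lt_or_gt_of_ne hml with h | h
    · refine PiTensorProduct.map_add_map_eq_zero m ?_ fun j hj => ?_
      · rw [threeWay_self, threeWay_of_lt _ _ _ h, hτd, neg_neg]
      · rcases lt_or_gt_of_ne hj with h' | h'
        · rw [threeWay_of_lt _ _ _ h', threeWay_of_lt _ _ _ (h'.trans h)]
        · rw [threeWay_of_gt _ _ _ h', Pi.one_apply, one_mul, mul_one]
    · rw [PiTensorProduct.map_eq_zero_of_coord m, PiTensorProduct.map_eq_zero_of_coord m,
        add_zero]
      · rw [threeWay_self, threeWay_of_gt _ _ _ h, hpd]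
      · rw [threeWay_self, threeWay_of_gt _ _ _ h, hdp]
  set Q : ℕ → Module.End K (⨂[K] l, V l) := fun k =>
    PiTensorProduct.map fun j : Fin n => if (j : ℕ) < k then 1 else p j with hQ
  have hdiag : ∀ l : Fin n,
      PiTensorProduct.map (threeWay τ d 1 l) * PiTensorProduct.map (threeWay τ s p l) +
      PiTensorProduct.map (threeWay τ s p l) * PiTensorProduct.map (threeWay τ d 1 l) =
      Q (l + 1) - Q l := by
    intro l
    set q : ∀ j : Fin n, Module.End K (V j) := fun j => if j < l then 1 else p j
    have hupd : ∀ (e : ∀ j : Fin n, Module.End K (V j)) (f : Module.End K (V l)), e l = f →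
        (∀ j, j < l → e j = 1) → (∀ j, l < j → e j = p j) → e = Function.update q l f := by
      intro e f h₀ h₁ h₂
      ext1 j
      rcases lt_trichotomy j l with h | rfl | h
      · simp [q, h, h.ne, h₁ j h]
      · simpa using h₀
      · simp [q, h.ne', h.not_gt, h₂ j h]
    have e₁ := hupd (fun j => threeWay τ d 1 l j * threeWay τ s p l j) (d l * s l)
      (by simp only [threeWay_self]) (fun j h => by simp only [threeWay_of_lt _ _ _ h, hττ])
      (fun j h => by simp only [threeWay_of_gt _ _ _ h, Pi.one_apply, one_mul])
    have e₂ := hupd (fun j => threeWay τ s p l j * threeWay τ d 1 l j) (s l * d l)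
      (by simp only [threeWay_self]) (fun j h => by simp only [threeWay_of_lt _ _ _ h, hττ])
      (fun j h => by simp only [threeWay_of_gt _ _ _ h, Pi.one_apply, mul_one])
    have e₃ := hupd (fun j => if (j : ℕ) < l + 1 then 1 else p j) 1 (by simp)
      (fun j h => if_pos (by omega)) (fun j h => if_neg (by omega))
    have e₄ := hupd (fun j => if (j : ℕ) < l then 1 else p j) (p l) (by simp)
      (fun j h => if_pos (by omega)) (fun j h => if_neg (by omega))
    rw [← PiTensorProduct.map_mul, ← PiTensorProduct.map_mul, eq_sub_iff_add_eq]
    simp only [hQ]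
    rw [e₁, e₂, e₃, e₄, ← PiTensorProduct.map_update_add, ← PiTensorProduct.map_update_add, hs,
      sub_add_cancel]
  rw [koszulDiff, Finset.sum_mul_sum, Finset.sum_mul_sum, Finset.sum_comm,
    ← Finset.sum_add_distrib]
  calc _ = ∑ l : Fin n, (Q (l + 1) - Q l) := by
        refine Finset.sum_congr rfl fun l _ => ?_
        rw [← Finset.sum_add_distrib, Finset.sum_eq_single l (fun m _ h => hne l m h) (by simp),
          hdiag]
    _ = Q n - Q 0 := by
        rw [Fin.sum_univ_eq_sum_range (fun k => Q (k + 1) - Q k), Finset.sum_range_sub]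
    _ = _ := by
        congr 1
        simp only [hQ, Fin.is_lt, if_true]
        exact PiTensorProduct.map_one

/-- A tensor product of complexes of vector spaces is exact away from the tensor product of the
augmentations. -/
lemma exists_koszulDiff_eq {W : Fin n → Type*} [∀ l, AddCommGroup (W l)] [∀ l, Module K (W l)]
    {τ d π : ∀ l, Module.End K (V l)} {ε : ∀ l, V l →ₗ[K] W l} (hττ : ∀ l, τ l * τ l = 1)
    (hτd : ∀ l, τ l * d l = -(d l * τ l)) (hdd : ∀ l, d l * d l = 0)
    (hεd : ∀ l, ε l ∘ₗ d l = 0) (hdπ : ∀ l, d l * π l = 0) (hεπ : ∀ l, ε l ∘ₗ π l = ε l)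
    (hex : ∀ l v, d l v = 0 → ε l v = 0 → ∃ w, d l w = v) (w : ⨂[K] l, V l)
    (hw : koszulDiff τ d w = 0) (hεw : PiTensorProduct.map ε w = 0) :
    ∃ w', koszulDiff τ d w' = w := by
  choose σ s hσ hs using fun l =>
    exists_contracting_homotopy (d l) (π l) (ε l) (hdd l) (hεd l) (hdπ l) (hεπ l) (hex l)
  have h := LinearMap.congr_fun (koszulDiff_homotopy (p := fun l => σ l ∘ₗ ε l) hττ hτd
    (fun l => by rw [Module.End.mul_eq_comp, ← LinearMap.comp_assoc, hσ, LinearMap.zero_comp])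
    (fun l => by rw [Module.End.mul_eq_comp, LinearMap.comp_assoc, hεd, LinearMap.comp_zero])
    hs) w
  simp only [LinearMap.add_apply, LinearMap.sub_apply, Module.End.mul_apply, hw, map_zero,
    add_zero, PiTensorProduct.map_comp, LinearMap.comp_apply, hεw, sub_zero,
    Module.End.one_apply] at h
  exact ⟨_, h⟩

end LinearAlgebra

section Factor

variable {R : Type*} [CommRing R] {r : ℕ → ℕ}

/-- The total space of a complex of free modules over `R`, the module in degree `i` having
rank `r i`. -/
abbrev TotalSpace (R : Type*) [CommRing R] (r : ℕ → ℕ) : Type _ := (Σ i, Fin (r i)) →₀ R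

/-- The total differential of the complex with matrices `M`. -/
noncomputable def totalDiff (M : ∀ i, Matrix (Fin (r i)) (Fin (r (i + 1))) R) :
    TotalSpace R r →ₗ[R] TotalSpace R r :=
  Finsupp.linearCombination R fun
    | ⟨0, _⟩ => 0
    | ⟨i + 1, b⟩ => ∑ a, Finsupp.single ⟨i, a⟩ (M i a b)

lemma totalDiff_apply (M : ∀ i, Matrix (Fin (r i)) (Fin (r (i + 1))) R) (v : TotalSpace R r)
    (i : ℕ) (a : Fin (r i)) :
    totalDiff M v ⟨i, a⟩ = ∑ b, M i a b * v ⟨i + 1, b⟩ := by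
  induction v using Finsupp.induction_linear with
  | zero => simp
  | add f g hf hg => simp [hf, hg, mul_add, Finset.sum_add_distrib]
  | single e t =>
    obtain ⟨j, b⟩ := e
    rw [totalDiff, Finsupp.linearCombination_single]
    rcases j with _ | j
    · simp
    · rcases eq_or_ne j i with rfl | h
      · simp [Finsupp.single_apply, mul_comm]
      · have h₁ : ∀ (a' : Fin (r j)),
            (⟨j, a'⟩ : Σ i, Fin (r i)) ≠ ⟨i, a⟩ := fun a' h' => h (congrArg Sigma.fst h')
        have h₂ : ∀ b' : Fin (r (i + 1)), (⟨j + 1, b⟩ : Σ i, Fin (r i)) ≠ ⟨i + 1, b'⟩ :=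
          fun b' h' => h (Nat.succ_injective (congrArg Sigma.fst h'))
        simp [h₁, h₂]

/-- The sign operator `(-1) ^ degree`. -/
noncomputable def totalSign (R : Type*) [CommRing R] (r : ℕ → ℕ) :
    TotalSpace R r →ₗ[R] TotalSpace R r :=
  Finsupp.linearCombination R fun e => Finsupp.single e ((-1) ^ e.1)

lemma totalSign_apply (v : TotalSpace R r) (e : Σ i, Fin (r i)) :
    totalSign R r v e = (-1) ^ e.1 * v e := by
  induction v using Finsupp.induction_linear with
  | zero => simp
  | add f g hf hg => simp [hf, hg, mul_add]
  | single e' t =>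
    rw [totalSign, Finsupp.linearCombination_single]
    rcases eq_or_ne e' e with rfl | h <;> simp [*, mul_comm]

/-- The projection onto degree zero. -/
noncomputable def degreeZeroProj (R : Type*) [CommRing R] (r : ℕ → ℕ) :
    TotalSpace R r →ₗ[R] TotalSpace R r :=
  Finsupp.linearCombination R fun e => if e.1 = 0 then Finsupp.single e 1 else 0

lemma degreeZeroProj_apply (v : TotalSpace R r) (e : Σ i, Fin (r i)) :
    degreeZeroProj R r v e = if e.1 = 0 then v e else 0 := by
  induction v using Finsupp.induction_linear with
  | zero => simp
  | add f g hf hg => split_ifs at * <;> simp [hf, hg]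
  | single e' t =>
    rw [degreeZeroProj, Finsupp.linearCombination_single]
    rcases eq_or_ne e' e with rfl | h
    · split_ifs <;> simp
    · split_ifs <;> simp [h]

/-- The augmentation on the total space, zero in positive degrees. -/
noncomputable def totalAug (g : Fin (r 0) → R) : TotalSpace R r →ₗ[R] R :=
  Finsupp.linearCombination R fun
    | ⟨0, d⟩ => g d
    | ⟨_ + 1, _⟩ => 0

lemma totalAug_apply (g : Fin (r 0) → R) (v : TotalSpace R r) :
    totalAug g v = ∑ d, g d * v ⟨0, d⟩ := by
  induction v using Finsupp.induction_linear with
  | zero => simp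
  | add f g hf hg => simp [hf, hg, mul_add, Finset.sum_add_distrib]
  | single e t =>
    obtain ⟨j, b⟩ := e
    rw [totalAug, Finsupp.linearCombination_single]
    rcases j with _ | j
    · simp [Finsupp.single_apply, mul_comm]
    · simp

lemma totalSign_totalSign (v : TotalSpace R r) : totalSign R r (totalSign R r v) = v := by
  ext e
  rw [totalSign_apply, totalSign_apply, ← mul_assoc, ← mul_pow]
  simp

lemma totalSign_totalDiff (M : ∀ i, Matrix (Fin (r i)) (Fin (r (i + 1))) R)
    (v : TotalSpace R r) :
    totalSign R r (totalDiff M v) = -totalDiff M (totalSign R r v) := by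
  ext ⟨i, a⟩
  simp only [totalSign_apply, totalDiff_apply, Finsupp.neg_apply, Finset.mul_sum,
    ← Finset.sum_neg_distrib]
  exact Finset.sum_congr rfl fun b _ => by ring

lemma totalDiff_degreeZeroProj (M : ∀ i, Matrix (Fin (r i)) (Fin (r (i + 1))) R)
    (v : TotalSpace R r) : totalDiff M (degreeZeroProj R r v) = 0 := by
  ext ⟨i, a⟩
  simp [totalDiff_apply, degreeZeroProj_apply]

lemma totalAug_degreeZeroProj (g : Fin (r 0) → R) (v : TotalSpace R r) :
    totalAug g (degreeZeroProj R r v) = totalAug g v := by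
  simp [totalAug_apply, degreeZeroProj_apply]

variable {M : ∀ i, Matrix (Fin (r i)) (Fin (r (i + 1))) R} {g : Fin (r 0) → R}

lemma totalDiff_totalDiff
    (hexact : ∀ i, LinearMap.range (Matrix.mulVecLin (M (i + 1))) =
      LinearMap.ker (Matrix.mulVecLin (M i))) (v : TotalSpace R r) :
    totalDiff M (totalDiff M v) = 0 := by
  ext ⟨i, a⟩
  have h : (M (i + 1)).mulVec (fun b => v ⟨i + 1 + 1, b⟩) ∈
      LinearMap.ker (Matrix.mulVecLin (M i)) := hexact i ▸ ⟨_, rfl⟩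
  have h' := congrFun (LinearMap.mem_ker.mp h) a
  simpa [totalDiff_apply, Matrix.mulVec, dotProduct] using h'

lemma totalAug_totalDiff
    (haug : ∀ u : Fin (r 0) → R, ∑ d, g d * u d = 0 ↔ ∃ v, (M 0).mulVec v = u)
    (v : TotalSpace R r) : totalAug g (totalDiff M v) = 0 := by
  rw [totalAug_apply]
  refine (haug _).mpr ⟨fun b => v ⟨1, b⟩, ?_⟩
  ext1 a
  rw [totalDiff_apply]
  rfl

lemma exists_totalDiff_eq
    (hexact : ∀ i, LinearMap.range (Matrix.mulVecLin (M (i + 1))) =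
      LinearMap.ker (Matrix.mulVecLin (M i)))
    (haug : ∀ u : Fin (r 0) → R, ∑ d, g d * u d = 0 ↔ ∃ v, (M 0).mulVec v = u)
    (v : TotalSpace R r) (hv : totalDiff M v = 0) (hgv : totalAug g v = 0) :
    ∃ w, totalDiff M w = v := by
  have hloc : ∀ i, ∃ w : Fin (r (i + 1)) → R, (M i).mulVec w = fun a => v ⟨i, a⟩ := by
    rintro (_ | i)
    · exact (haug _).mp (by rw [← hgv, totalAug_apply])
    · have h : (fun a => v ⟨i + 1, a⟩) ∈ LinearMap.ker (Matrix.mulVecLin (M i)) := by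
        rw [LinearMap.mem_ker]
        ext1 a
        exact (totalDiff_apply M v i a).symm.trans (by rw [hv]; rfl)
      rw [← hexact i] at h
      exact h
  choose w hw using hloc
  classical
  set S := v.support.image Sigma.fst with hS
  let f : (Σ i, Fin (r i)) → R
    | ⟨0, _⟩ => 0
    | ⟨i + 1, b⟩ => if i ∈ S then w i b else 0
  refine ⟨Finsupp.onFinset ((S.image Nat.succ).sigma fun _ => Finset.univ) f ?_, ?_⟩
  · rintro ⟨_ | i, b⟩ h
    · exact absurd rfl h
    · have : i ∈ S := by by_contra hi; exact h (if_neg hi)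
      simpa using this
  · ext ⟨i, a⟩
    rw [totalDiff_apply]
    simp only [Finsupp.onFinset_apply, f]
    by_cases hi : i ∈ S
    · simp only [hi, if_true]
      exact congrFun (hw i) a
    · have : v ⟨i, a⟩ = 0 := by
        by_contra h
        exact hi (Finset.mem_image_of_mem Sigma.fst (Finsupp.mem_support_iff.mpr h))
      simp [hi, this]

end Factor

section Tensor

variable {K : Type} [Field K] {n : ℕ} {mfam : Fin n → ℕ} {rl : Fin n → ℕ → ℕ}
  {Ml : ∀ l i, Matrix (Fin (rl l i)) (Fin (rl l (i + 1))) (MvPolynomial (Fin (mfam l)) K)}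
  {gl : ∀ l, Fin (rl l 0) → MvPolynomial (Fin (mfam l)) K}

open PiTensorProduct TensorProduct

/-- Multiplication `⨂ K[x_l] → K[x]` for a partition of the variables `x` into groups `x_l`. -/
noncomputable def tensorToPoly (K : Type) [Field K] {n : ℕ} (mfam : Fin n → ℕ) :
    (⨂[K] l, MvPolynomial (Fin (mfam l)) K) →ₐ[K] MvPolynomial ((i : Fin n) × Fin (mfam i)) K :=
  PiTensorProduct.liftAlgHom
    ((MultilinearMap.mkPiAlgebra K (Fin n) _).compLinearMap
      fun l => (rename (Sigma.mk (β := fun i => Fin (mfam i)) l)).toLinearMap)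
    (by simp) (fun x y => by simp [Finset.prod_mul_distrib])

lemma tensorToPoly_tprod (p : ∀ l, MvPolynomial (Fin (mfam l)) K) :
    tensorToPoly K mfam (tprod K p) = ∏ l, rename (Sigma.mk l) (p l) :=
  (PiTensorProduct.lift.tprod p).trans (by simp)

/-- A polynomial ring is the tensor product of the polynomial rings in the parts of a partition
of its variables. -/
noncomputable def tensorEquivPoly (K : Type) [Field K] {n : ℕ} (mfam : Fin n → ℕ) :
    (⨂[K] l, MvPolynomial (Fin (mfam l)) K) ≃ₐ[K] MvPolynomial ((i : Fin n) × Fin (mfam i)) K :=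
  AlgEquiv.ofAlgHom (tensorToPoly K mfam)
    (aeval fun v => PiTensorProduct.singleAlgHom (R := K)
      (A := fun l => MvPolynomial (Fin (mfam l)) K) v.1 (X v.2))
    (by
      ext1 v
      simp only [AlgHom.comp_apply, aeval_X, AlgHom.id_apply]
      change tensorToPoly K mfam (tprod K (Pi.mulSingle v.1 (X v.2))) = _
      rw [tensorToPoly_tprod, Finset.prod_eq_single v.1]
      · simp
      · intro l _ hl
        simp [hl]
      · simp)
    (by
      ext l v
      simp only [AlgHom.comp_apply, AlgHom.id_apply]
      change aeval _ (tensorToPoly K mfam (tprod K (Pi.mulSingle l (X v)))) = _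
      rw [tensorToPoly_tprod, Finset.prod_eq_single l]
      · simp
      · intro l' _ hl'
        simp [hl']
      · simp)

lemma tensorEquivPoly_tprod (p : ∀ l, MvPolynomial (Fin (mfam l)) K) :
    tensorEquivPoly K mfam (tprod K p) = ∏ l, rename (Sigma.mk l) (p l) :=
  tensorToPoly_tprod p

/-- The `K`-tensor product of the total spaces of complexes of free `K[x_l]`-modules is a free
`K[x]`-module on the product of the bases. -/
noncomputable def totalEquiv (K : Type) [Field K] {n : ℕ} (mfam : Fin n → ℕ)
    (rl : Fin n → ℕ → ℕ) :
    (⨂[K] l, TotalSpace (MvPolynomial (Fin (mfam l)) K) (rl l)) ≃ₗ[K]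
      ((∀ l, Σ i, Fin (rl l i)) →₀ MvPolynomial ((i : Fin n) × Fin (mfam i)) K) :=
  letI : ∀ l, DecidableEq (MvPolynomial (Fin (mfam l)) K) := fun _ => Classical.decEq _
  PiTensorProduct.ofFinsuppEquiv ≪≫ₗ
    Finsupp.mapRange.linearEquiv (tensorEquivPoly K mfam).toLinearEquiv

lemma totalEquiv_tprod (v : ∀ l, TotalSpace (MvPolynomial (Fin (mfam l)) K) (rl l))
    (e : ∀ l, Σ i, Fin (rl l i)) :
    totalEquiv K mfam rl (tprod K v) e = ∏ l, rename (Sigma.mk l) (v l (e l)) := by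
  simp [totalEquiv, tensorEquivPoly_tprod]

/-- The family of basis elements underlying an element of `TensIdx rl k`. -/
def TensIdx.toFamily {k : ℕ} (x : TensIdx rl k) (l : Fin n) : Σ i, Fin (rl l i) :=
  ⟨x.1.1 l, x.2 l⟩

lemma TensIdx.sum_toFamily {k : ℕ} (x : TensIdx rl k) :
    ∑ l, (TensIdx.toFamily x l).1 = k := x.1.2

lemma TensIdx.exists_toFamily_eq (e : ∀ l, Σ i, Fin (rl l i)) :
    ∃ x : TensIdx rl (∑ l, (e l).1), TensIdx.toFamily x = e :=
  ⟨⟨⟨fun l => ⟨(e l).1, Nat.lt_succ_of_le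
    (Finset.single_le_sum (f := fun l => (e l).1) (fun _ _ => Nat.zero_le _)
      (Finset.mem_univ l))⟩, rfl⟩, fun l => (e l).2⟩, rfl⟩

lemma TensIdx.toFamily_injective {k : ℕ} :
    Function.Injective (TensIdx.toFamily : TensIdx rl k → ∀ l, Σ i, Fin (rl l i)) := by
  rintro ⟨⟨c, hc⟩, f⟩ ⟨⟨c', hc'⟩, f'⟩ h
  have h₁ : c = c' := funext fun l => Fin.ext (congrArg Sigma.fst (congrFun h l))
  subst h₁
  have h₂ : f = f' := funext fun l => by
    have := congrFun h l
    simpa [TensIdx.toFamily] using this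
  rw [h₂]

lemma toFamily_tensIdxSucc {k : ℕ} (x : TensIdx rl k) (l : Fin n)
    (d : Fin (rl l ((x.1.1 l : ℕ) + 1))) :
    TensIdx.toFamily (tensIdxSucc rl x.1 l d x.2) =
      Function.update (TensIdx.toFamily x) l ⟨x.1.1 l + 1, d⟩ := by
  have hcast : ∀ {l : Fin n} {i j : ℕ} (h : rl l i = rl l j) (a : Fin (rl l i)), i = j →
      (⟨j, Fin.cast h a⟩ : Σ i, Fin (rl l i)) = ⟨i, a⟩ := by
    rintro l i _ h a rfl
    rfl
  ext1 l'
  rcases eq_or_ne l' l with rfl | h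
  · simp only [TensIdx.toFamily, tensIdxSucc, Function.update_self, dite_true]
    exact hcast _ _ (by simp)
  · simp only [TensIdx.toFamily, tensIdxSucc, Function.update_of_ne h, h, dite_false]
    exact hcast _ _ (by simp [h])

lemma tensDiff_zero (k : ℕ) : tensDiff mfam rl Ml k 0 = 0 := by
  ext1 x
  simp [tensDiff]

lemma tensDiff_add (k : ℕ) (u v : TensIdx rl (k + 1) → _) :
    tensDiff mfam rl Ml k (u + v) = tensDiff mfam rl Ml k u + tensDiff mfam rl Ml k v := by
  ext1 x
  simp [tensDiff, mul_add, Finset.sum_add_distrib]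

lemma tensDiff_smul (k : ℕ) (a : K) (u : TensIdx rl (k + 1) → _) :
    tensDiff mfam rl Ml k (a • u) = a • tensDiff mfam rl Ml k u := by
  ext1 x
  simp only [tensDiff, Pi.smul_apply, mul_smul_comm, ← Finset.smul_sum]

lemma tensAug_add (u v : TensIdx rl 0 → _) :
    tensAug mfam rl gl (u + v) = tensAug mfam rl gl u + tensAug mfam rl gl v := by
  simp [tensAug, mul_add, Finset.sum_add_distrib]

lemma tensAug_smul (a : K) (u : TensIdx rl 0 → _) :
    tensAug mfam rl gl (a • u) = a • tensAug mfam rl gl u := by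
  simp [tensAug, Finset.smul_sum]

/-- The degree `k` part of an element of the tensor product of total spaces. -/
noncomputable def degreePart (K : Type) [Field K] {n : ℕ} (mfam : Fin n → ℕ)
    (rl : Fin n → ℕ → ℕ) (k : ℕ) :
    (⨂[K] l, TotalSpace (MvPolynomial (Fin (mfam l)) K) (rl l)) →ₗ[K]
      (TensIdx rl k → MvPolynomial ((i : Fin n) × Fin (mfam i)) K) :=
  LinearMap.funLeft K _ TensIdx.toFamily ∘ₗ Finsupp.lcoeFun ∘ₗ (totalEquiv K mfam rl).toLinearMap

lemma degreePart_apply {k : ℕ} (w : ⨂[K] l, TotalSpace (MvPolynomial (Fin (mfam l)) K) (rl l))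
    (x : TensIdx rl k) :
    degreePart K mfam rl k w x = totalEquiv K mfam rl w (TensIdx.toFamily x) := rfl

lemma degreePart_tprod {k : ℕ} (v : ∀ l, TotalSpace (MvPolynomial (Fin (mfam l)) K) (rl l))
    (x : TensIdx rl k) :
    degreePart K mfam rl k (tprod K v) x =
      ∏ l, rename (Sigma.mk l) (v l (TensIdx.toFamily x l)) := totalEquiv_tprod v _

lemma eq_zero_of_degreePart_eq_zero
    {w : ⨂[K] l, TotalSpace (MvPolynomial (Fin (mfam l)) K) (rl l)}
    (h : ∀ k, degreePart K mfam rl k w = 0) : w = 0 := by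
  rw [← (totalEquiv K mfam rl).map_eq_zero_iff]
  ext1 e
  obtain ⟨x, hx⟩ := TensIdx.exists_toFamily_eq e
  rw [← hx]
  exact congrFun (h _) x

/-- Every element of degree `k` lifts to the tensor product of total spaces. -/
lemma exists_degreePart_eq {k : ℕ}
    (u : TensIdx rl k → MvPolynomial ((i : Fin n) × Fin (mfam i)) K) :
    ∃ w, degreePart K mfam rl k w = u ∧ ∀ j, j ≠ k → degreePart K mfam rl j w = 0 := by
  refine ⟨(totalEquiv K mfam rl).symm (Finsupp.embDomain ⟨_, TensIdx.toFamily_injective⟩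
    (Finsupp.equivFunOnFinite.symm u)), ?_, fun j hj => ?_⟩
  · ext1 x
    rw [degreePart_apply, LinearEquiv.apply_symm_apply]
    exact Finsupp.embDomain_apply_self ⟨_, TensIdx.toFamily_injective⟩ _ x
  · ext1 x
    rw [degreePart_apply, LinearEquiv.apply_symm_apply]
    refine Finsupp.embDomain_of_notMem_range _ _ _ ?_
    rintro ⟨y, hy⟩
    refine hj ?_
    rw [← TensIdx.sum_toFamily x, ← TensIdx.sum_toFamily y]
    exact Finset.sum_congr rfl fun l _ => congrArg Sigma.fst (congrFun hy.symm l)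

/-- The differential of the tensor product on the tensor product of total spaces. -/
noncomputable def tensorTotalDiff
    (Ml : ∀ l i, Matrix (Fin (rl l i)) (Fin (rl l (i + 1))) (MvPolynomial (Fin (mfam l)) K)) :
    Module.End K (⨂[K] l, TotalSpace (MvPolynomial (Fin (mfam l)) K) (rl l)) :=
  koszulDiff (fun l => (totalSign _ (rl l)).restrictScalars K)
    (fun l => (totalDiff (Ml l)).restrictScalars K)

lemma degreePart_tensorTotalDiff (k : ℕ)
    (w : ⨂[K] l, TotalSpace (MvPolynomial (Fin (mfam l)) K) (rl l)) :
    degreePart K mfam rl k (tensorTotalDiff Ml w) =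
      tensDiff mfam rl Ml k (degreePart K mfam rl (k + 1) w) := by
  induction w using PiTensorProduct.induction_on with
  | add x y hx hy => simp only [map_add, tensDiff_add, hx, hy]
  | smul_tprod a v =>
    simp only [map_smul, tensDiff_smul]
    congr 1
    ext1 x
    rw [tensorTotalDiff, koszulDiff, LinearMap.sum_apply, map_sum, Finset.sum_apply, tensDiff]
    refine Finset.sum_congr rfl fun l _ => ?_
    rw [PiTensorProduct.map_tprod, degreePart_tprod,
      ← Finset.mul_prod_erase _ _ (Finset.mem_univ l), threeWay_self]
    have h₁ : ∀ j ∈ Finset.univ.erase l,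
        rename (Sigma.mk (β := fun i => Fin (mfam i)) j)
        ((threeWay (fun l => (totalSign _ (rl l)).restrictScalars K)
          (fun l => (totalDiff (Ml l)).restrictScalars K) 1 l j (v j)) (TensIdx.toFamily x j)) =
        (if j < l then (-1) ^ (x.1.1 j : ℕ) else 1) *
          rename (Sigma.mk (β := fun i => Fin (mfam i)) j)
            (v j (TensIdx.toFamily x j)) := by
      intro j hj
      rcases lt_or_gt_of_ne (Finset.ne_of_mem_erase hj) with h | h
      · rw [threeWay_of_lt _ _ _ h, if_pos h, LinearMap.coe_restrictScalars, totalSign_apply]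
        simp [TensIdx.toFamily]
      · rw [threeWay_of_gt _ _ _ h, if_neg h.not_gt, one_mul]
        rfl
    have h₂ : ∏ j ∈ Finset.univ.erase l, (if j < l then
          (-1 : MvPolynomial ((i : Fin n) × Fin (mfam i)) K) ^ (x.1.1 j : ℕ) else 1) =
        (-1) ^ ∑ j ∈ Finset.univ.filter (fun j => j < l), (x.1.1 j : ℕ) := by
      rw [← Finset.prod_filter, Finset.prod_pow_eq_pow_sum]
      congr 2
      ext j
      simp +contextual [ne_of_lt]
    have h₃ : ∀ d, degreePart K mfam rl (k + 1) (tprod K v) (tensIdxSucc rl x.1 l d x.2) =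
        rename (Sigma.mk l) (v l ⟨x.1.1 l + 1, d⟩) *
          ∏ j ∈ Finset.univ.erase l, rename (Sigma.mk j) (v j (TensIdx.toFamily x j)) := by
      intro d
      rw [degreePart_tprod, ← Finset.mul_prod_erase _ _ (Finset.mem_univ l), toFamily_tensIdxSucc,
        Function.update_self]
      congr 1
      refine Finset.prod_congr rfl fun j hj => ?_
      rw [Function.update_of_ne (Finset.ne_of_mem_erase hj)]
    rw [Finset.prod_congr rfl h₁, Finset.prod_mul_distrib, h₂, LinearMap.coe_restrictScalars]
    simp only [h₃]
    rw [TensIdx.toFamily, totalDiff_apply, map_sum]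
    simp only [map_mul, ← mul_assoc]
    rw [← Finset.sum_mul]
    ring

/-- The augmentation on the tensor product of total spaces. -/
noncomputable def tensorTotalAug (gl : ∀ l, Fin (rl l 0) → MvPolynomial (Fin (mfam l)) K) :
    (⨂[K] l, TotalSpace (MvPolynomial (Fin (mfam l)) K) (rl l)) →ₗ[K]
      ⨂[K] l, MvPolynomial (Fin (mfam l)) K :=
  PiTensorProduct.map fun l => (totalAug (gl l)).restrictScalars K

lemma tensIdxZero_bijective : Function.Bijective
    (fun f : ∀ l, Fin (rl l 0) => (⟨⟨fun _ => 0, by simp⟩, f⟩ : TensIdx rl 0)) := by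
  constructor
  · intro f f' h
    simpa using h
  · rintro ⟨⟨c, hc⟩, f⟩
    obtain rfl : c = fun _ => 0 := funext fun l => Fin.fin_one_eq_zero (c l)
    exact ⟨f, rfl⟩

lemma tensorEquivPoly_tensorTotalAug
    (w : ⨂[K] l, TotalSpace (MvPolynomial (Fin (mfam l)) K) (rl l)) :
    tensorEquivPoly K mfam (tensorTotalAug gl w) =
      tensAug mfam rl gl (degreePart K mfam rl 0 w) := by
  induction w using PiTensorProduct.induction_on with
  | add x y hx hy => simp only [map_add, tensAug_add, hx, hy]
  | smul_tprod a v =>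
    simp only [map_smul, tensAug_smul]
    congr 1
    rw [tensorTotalAug, PiTensorProduct.map_tprod, tensorEquivPoly_tprod, tensAug,
      ← tensIdxZero_bijective.sum_comp]
    simp only [LinearMap.coe_restrictScalars, totalAug_apply, map_sum, map_mul]
    rw [Finset.prod_univ_sum, Fintype.piFinset_univ]
    refine Finset.sum_congr rfl fun f _ => ?_
    rw [degreePart_tprod, Finset.prod_mul_distrib]
    rfl

lemma tensorTotalAug_tensorTotalDiff
    (haugker : ∀ (l : Fin n) (u : Fin (rl l 0) → MvPolynomial (Fin (mfam l)) K),
      (∑ d, gl l d * u d) = 0 ↔ ∃ v, Matrix.mulVec (Ml l 0) v = u)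
    (w : ⨂[K] l, TotalSpace (MvPolynomial (Fin (mfam l)) K) (rl l)) :
    tensorTotalAug gl (tensorTotalDiff Ml w) = 0 := by
  rw [tensorTotalDiff, koszulDiff, LinearMap.sum_apply, map_sum]
  refine Finset.sum_eq_zero fun l _ => ?_
  rw [tensorTotalAug, ← LinearMap.comp_apply, ← PiTensorProduct.map_comp,
    PiTensorProduct.map_eq_zero_of_coord l, LinearMap.zero_apply]
  rw [threeWay_self]
  exact LinearMap.ext fun v => totalAug_totalDiff (haugker l) v

lemma tensorTotalDiff_tensorTotalDiff
    (hexact : ∀ l i, LinearMap.range (Matrix.mulVecLin (Ml l (i + 1))) =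
      LinearMap.ker (Matrix.mulVecLin (Ml l i)))
    (w : ⨂[K] l, TotalSpace (MvPolynomial (Fin (mfam l)) K) (rl l)) :
    tensorTotalDiff Ml (tensorTotalDiff Ml w) = 0 :=
  LinearMap.congr_fun (koszulDiff_mul_self
    (fun l => LinearMap.ext fun v => totalDiff_totalDiff (hexact l) v)
    (fun l => LinearMap.ext fun v => totalSign_totalDiff (Ml l) v)) w

/-- The tensor product of total spaces is exact away from the augmentation. -/
lemma exists_tensorTotalDiff_eq
    (hexact : ∀ l i, LinearMap.range (Matrix.mulVecLin (Ml l (i + 1))) =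
      LinearMap.ker (Matrix.mulVecLin (Ml l i)))
    (haugker : ∀ (l : Fin n) (u : Fin (rl l 0) → MvPolynomial (Fin (mfam l)) K),
      (∑ d, gl l d * u d) = 0 ↔ ∃ v, Matrix.mulVec (Ml l 0) v = u)
    (w : ⨂[K] l, TotalSpace (MvPolynomial (Fin (mfam l)) K) (rl l))
    (hw : tensorTotalDiff Ml w = 0) (hgw : tensorTotalAug gl w = 0) :
    ∃ w', tensorTotalDiff Ml w' = w := by
  unfold tensorTotalDiff at *
  unfold tensorTotalAug at hgw
  refine exists_koszulDiff_eq
    (π := fun l => (degreeZeroProj (MvPolynomial (Fin (mfam l)) K) (rl l)).restrictScalars K)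
    (ε := fun l => (totalAug (gl l)).restrictScalars K) ?_ ?_ ?_ ?_ ?_ ?_ ?_ w hw hgw
  · exact fun l => LinearMap.ext fun v => totalSign_totalSign v
  · exact fun l => LinearMap.ext fun v => totalSign_totalDiff (Ml l) v
  · exact fun l => LinearMap.ext fun v => totalDiff_totalDiff (hexact l) v
  · exact fun l => LinearMap.ext fun v => totalAug_totalDiff (haugker l) v
  · exact fun l => LinearMap.ext fun v => totalDiff_degreeZeroProj (Ml l) v
  · exact fun l => LinearMap.ext fun v => totalAug_degreeZeroProj (gl l) v
  · exact fun l v hv hgv => exists_totalDiff_eq (hexact l) (haugker l) v hv hgv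

/-- A cycle of the tensor product complex which is killed by the augmentation when it has
degree zero is a boundary. -/
lemma exists_tensDiff_eq
    (hexact : ∀ l i, LinearMap.range (Matrix.mulVecLin (Ml l (i + 1))) =
      LinearMap.ker (Matrix.mulVecLin (Ml l i)))
    (haugker : ∀ (l : Fin n) (u : Fin (rl l 0) → MvPolynomial (Fin (mfam l)) K),
      (∑ d, gl l d * u d) = 0 ↔ ∃ v, Matrix.mulVec (Ml l 0) v = u)
    {k : ℕ} {w : ⨂[K] l, TotalSpace (MvPolynomial (Fin (mfam l)) K) (rl l)}
    (hdiff : ∀ j, tensDiff mfam rl Ml j (degreePart K mfam rl (j + 1) w) = 0)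
    (haug : tensAug mfam rl gl (degreePart K mfam rl 0 w) = 0) :
    ∃ v, tensDiff mfam rl Ml k v = degreePart K mfam rl k w := by
  obtain ⟨w', rfl⟩ := exists_tensorTotalDiff_eq hexact haugker w
    (eq_zero_of_degreePart_eq_zero fun j => by rw [degreePart_tensorTotalDiff, hdiff])
    ((EmbeddingLike.map_eq_zero_iff (f := tensorEquivPoly K mfam)).mp
      (by rw [tensorEquivPoly_tensorTotalAug, haug]))
  exact ⟨_, (degreePart_tensorTotalDiff k w').symm⟩

open scoped Pointwise in
/-- The image of the augmentation is the product of the ideals generated by the `gl l`. -/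
lemma exists_tensAug_eq_iff (t : MvPolynomial ((i : Fin n) × Fin (mfam i)) K) :
    (∃ u, tensAug mfam rl gl u = t) ↔
      t ∈ ∏ l, Ideal.map (rename (Sigma.mk (β := fun i => Fin (mfam i)) l) :
        MvPolynomial (Fin (mfam l)) K →ₐ[K] _).toRingHom (Ideal.span (Set.range (gl l))) := by
  have hset : ∏ l, (rename (Sigma.mk (β := fun i => Fin (mfam i)) l) :
        MvPolynomial (Fin (mfam l)) K →ₐ[K] _).toRingHom '' Set.range (gl l) =
      Set.range fun x : TensIdx rl 0 => ∏ l, rename (Sigma.mk (β := fun i => Fin (mfam i)) l)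
        (gl l (Fin.cast
          (by rw [Finset.sum_eq_zero_iff.mp x.1.2 l (Finset.mem_univ l)]) (x.2 l))) := by
    rw [← tensIdxZero_bijective.surjective.range_comp]
    ext p
    rw [Set.mem_fintype_prod]
    constructor
    · rintro ⟨q, hq, rfl⟩
      choose f hf using fun l => (hq : ∀ l, _) l
      choose d hd using fun l => (hf l).1
      refine ⟨d, Finset.prod_congr rfl fun l _ => ?_⟩
      rw [← (hf l).2, ← hd l]
      rfl
    · rintro ⟨d, rfl⟩
      exact ⟨_, fun l => ⟨_, ⟨d l, rfl⟩, rfl⟩, rfl⟩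
  simp only [Ideal.map_span, Ideal.prod_span]
  rw [hset, Ideal.mem_span_range_iff_exists_fun]
  simp only [tensAug, mul_comm]

lemma tensDiff_single_mem
    (hmin : ∀ l i k c, Ml l i k c ∈
      Ideal.span (Set.range (X : Fin (mfam l) → MvPolynomial (Fin (mfam l)) K)))
    (k : ℕ) (u : TensIdx rl (k + 1) → _) (y : TensIdx rl k) :
    tensDiff mfam rl Ml k u y ∈ Ideal.span (Set.range (X : ((i : Fin n) × Fin (mfam i)) →
      MvPolynomial ((i : Fin n) × Fin (mfam i)) K)) := by
  refine Ideal.sum_mem _ fun l _ => Ideal.mul_mem_left _ _ <|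
    Ideal.sum_mem _ fun d _ => Ideal.mul_mem_right _ _ ?_
  have h := Ideal.mem_map_of_mem (rename (Sigma.mk (β := fun i => Fin (mfam i)) l) :
    MvPolynomial (Fin (mfam l)) K →ₐ[K] _).toRingHom (hmin l _ (y.2 l) d)
  rw [Ideal.map_span] at h
  refine Ideal.span_mono ?_ h
  rintro _ ⟨_, ⟨v, rfl⟩, rfl⟩
  exact ⟨⟨l, v⟩, (rename_X _ _).symm⟩

end Tensor

section Homogeneous

variable {K : Type} [Field K] {τ : Type} [Fintype τ] [DecidableEq τ] {b₁ b₂ : τ → ℕ}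

lemma IsHomogEntry.zero : IsHomogEntry K b₁ b₂ 0 := ⟨0, by simp, fun h => absurd rfl h⟩

lemma IsHomogEntry.add {f g : MvPolynomial τ K} (hf : IsHomogEntry K b₁ b₂ f)
    (hg : IsHomogEntry K b₁ b₂ g) : IsHomogEntry K b₁ b₂ (f + g) := by
  obtain ⟨a, rfl, ha⟩ := hf
  obtain ⟨b, rfl, hb⟩ := hg
  refine ⟨a + b, (add_smul _ _ _).symm, fun h => ?_⟩
  by_cases ha' : a = 0
  · exact hb fun hb' => h (by rw [ha', hb', add_zero])
  · exact ha ha'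

lemma IsHomogEntry.sum {ι : Type*} (s : Finset ι) {f : ι → MvPolynomial τ K}
    (hf : ∀ i ∈ s, IsHomogEntry K b₁ b₂ (f i)) : IsHomogEntry K b₁ b₂ (∑ i ∈ s, f i) :=
  Finset.sum_induction f _ (fun _ _ => IsHomogEntry.add) IsHomogEntry.zero hf

lemma IsHomogEntry.smul {f : MvPolynomial τ K} (hf : IsHomogEntry K b₁ b₂ f) (c : K) :
    IsHomogEntry K b₁ b₂ (c • f) := by
  obtain ⟨a, rfl, ha⟩ := hf
  exact ⟨c * a, smul_smul _ _ _, fun h => ha (right_ne_zero_of_mul h)⟩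

lemma IsHomogEntry.rename_mk {n : ℕ} {mfam : Fin n → ℕ} {l : Fin n}
    {f : MvPolynomial (Fin (mfam l)) K} {B₁ B₂ : ((i : Fin n) × Fin (mfam i)) → ℕ}
    (hf : IsHomogEntry K (fun v => B₁ ⟨l, v⟩) (fun v => B₂ ⟨l, v⟩) f)
    (hB : ∀ v : (i : Fin n) × Fin (mfam i), v.1 ≠ l → B₁ v = B₂ v) :
    IsHomogEntry K B₁ B₂ (rename (Sigma.mk (β := fun i => Fin (mfam i)) l) f) := by
  obtain ⟨a, rfl, ha⟩ := hf
  refine ⟨a, ?_, fun h v => ?_⟩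
  · rw [map_smul, rename_monomial]
    refine congrArg (fun e => a • monomial e (1 : K)) (Finsupp.ext ?_)
    rintro ⟨l', v⟩
    rcases eq_or_ne l' l with rfl | h
    · rw [Finsupp.mapDomain_apply sigma_mk_injective]
      rfl
    · rw [Finsupp.mapDomain_of_notMem_range]
      · simp [hB ⟨l', v⟩ h]
      · rintro ⟨v', hv'⟩
        exact h (congrArg Sigma.fst hv').symm
  · rcases eq_or_ne v.1 l with h' | h'
    · obtain ⟨l', v⟩ := v
      subst h'
      exact ha h v
    · exact (hB v h').le

lemma isHomogEntry_tensDiff_single {n : ℕ} {mfam : Fin n → ℕ} {rl : Fin n → ℕ → ℕ}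
    {bl : ∀ (l : Fin n) (i : ℕ), Fin (rl l i) → Fin (mfam l) → ℕ}
    {Ml : ∀ l i, Matrix (Fin (rl l i)) (Fin (rl l (i + 1))) (MvPolynomial (Fin (mfam l)) K)}
    (hhom : ∀ l i k c, IsHomogEntry K (bl l i k) (bl l (i + 1) c) (Ml l i k c))
    (k : ℕ) (x : TensIdx rl (k + 1)) (y : TensIdx rl k) :
    IsHomogEntry K (fun v => bl v.1 (y.1.1 v.1) (y.2 v.1) v.2)
      (fun v => bl v.1 (x.1.1 v.1) (x.2 v.1) v.2)
      (tensDiff mfam rl Ml k (Pi.single x 1) y) := by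
  refine IsHomogEntry.sum _ fun l _ => ?_
  have hsign : ∀ (s : ℕ) (f : MvPolynomial ((i : Fin n) × Fin (mfam i)) K),
      (-1) ^ s * f = ((-1 : K) ^ s) • f := fun s f => by simp [smul_eq_C_mul]
  rw [hsign]
  refine (IsHomogEntry.sum _ fun d _ => ?_).smul _
  by_cases hx : tensIdxSucc rl y.1 l d y.2 = x
  · have hfam : TensIdx.toFamily x = Function.update (TensIdx.toFamily y) l ⟨y.1.1 l + 1, d⟩ := by
      rw [← hx, toFamily_tensIdxSucc]
    rw [hx, Pi.single_eq_same, mul_one]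
    refine IsHomogEntry.rename_mk ?_ fun v hv => ?_
    · have h₂ : (fun v => bl l (x.1.1 l) (x.2 l) v) = bl l (y.1.1 l + 1) d :=
        congrArg (fun e : Σ i, Fin (rl l i) => bl l e.1 e.2)
          ((congrFun hfam l).trans (Function.update_self ..))
      simp only [h₂]
      exact hhom l _ _ d
    · exact congrArg (fun e : Σ i, Fin (rl v.1 i) => bl v.1 e.1 e.2 v.2)
        ((congrFun hfam v.1).trans (Function.update_of_ne hv ..)).symm
  · rw [Pi.single_eq_of_ne hx, mul_zero]
    exact IsHomogEntry.zero

end Homogeneous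

/-- **Proposition.** Let `I_1, …, I_n` be monomial ideals of
`T = K[x_{11}, …, x_{n m_n}]`, where `I_l = I_l' T` is generated by monomials in the
`l`-th group of variables (`I_l'` a monomial ideal of `T_l = K[x_{l1}, …, x_{l m_l}]`),
and for each `l` let `H^{(l)}` be a minimal `ℤ^{m_l}`-graded free `T_l`-resolution of
`I_l'` (with ranks `rl l`, shifts `bl l`, differential matrices `Ml l` and
augmentation `gl l : H^{(l)}_0 → I_l'`).  Then the tensor product complex
`H^{(1)} ⊗ ⋯ ⊗ H^{(n)}` over `T` is a minimal `ℤ^N`-graded free `T`-resolution of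
the product ideal `I_1 I_2 ⋯ I_n`: it is a complex, exact in positive degrees, its
augmentation has kernel the image of the first differential and image
`I_1 I_2 ⋯ I_n`, its differential has entries in the graded maximal ideal, and it is
multigraded with respect to the product shifts. -/
theorem tensor_product_of_resolutions_is_minimal_free_resolution
    {K : Type} [Field K] {n : ℕ} (mfam : Fin n → ℕ)
    (Jl : ∀ l : Fin n, Ideal (MvPolynomial (Fin (mfam l)) K))
    (hJmon : ∀ l, IsMonomialIdeal (Jl l))
    (rl : Fin n → ℕ → ℕ)
    (bl : ∀ (l : Fin n) (i : ℕ), Fin (rl l i) → Fin (mfam l) → ℕ)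
    (Ml : ∀ (l : Fin n) (i : ℕ),
      Matrix (Fin (rl l i)) (Fin (rl l (i + 1))) (MvPolynomial (Fin (mfam l)) K))
    (gl : ∀ l, Fin (rl l 0) → MvPolynomial (Fin (mfam l)) K)
    -- `H^{(l)}` is a resolution of the ideal `I_l' = Jl l` of `T_l` …
    (hexact : ∀ l i, LinearMap.range (Matrix.mulVecLin (Ml l (i + 1))) =
      LinearMap.ker (Matrix.mulVecLin (Ml l i)))
    (haugker : ∀ (l : Fin n) (u : Fin (rl l 0) → MvPolynomial (Fin (mfam l)) K),
      (∑ d, gl l d * u d) = 0 ↔ ∃ v, Matrix.mulVec (Ml l 0) v = u)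
    (hspan : ∀ l, Ideal.span (Set.range (gl l)) = Jl l)
    -- … which is minimal and `ℤ^{m_l}`-graded with shifts `bl l`:
    (hmin : ∀ l i k c, Ml l i k c ∈
      Ideal.span (Set.range (X : Fin (mfam l) → MvPolynomial (Fin (mfam l)) K)))
    (hhom : ∀ l i k c, IsHomogEntry K (bl l i k) (bl l (i + 1) c) (Ml l i k c))
    (hghom : ∀ l d, IsHomogEntry K (fun _ => 0) (bl l 0 d) (gl l d)) :
    -- the tensor product complex is a complex:
    (∀ (k : ℕ) (u : TensIdx rl (k + 2) → MvPolynomial ((i : Fin n) × Fin (mfam i)) K),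
        tensDiff mfam rl Ml k (tensDiff mfam rl Ml (k + 1) u) = 0) ∧
    -- exact in positive homological degrees:
    (∀ (k : ℕ) (u : TensIdx rl (k + 1) → MvPolynomial ((i : Fin n) × Fin (mfam i)) K),
        tensDiff mfam rl Ml k u = 0 → ∃ v, tensDiff mfam rl Ml (k + 1) v = u) ∧
    -- it resolves the product ideal `I_1 I_2 ⋯ I_n ⊆ T`:
    (∀ t : MvPolynomial ((i : Fin n) × Fin (mfam i)) K,
        (∃ u, tensAug mfam rl gl u = t) ↔
          t ∈ ∏ l, Ideal.map (rename (fun v => (⟨l, v⟩ : (i : Fin n) × Fin (mfam i))) : MvPolynomial (Fin (mfam l)) K →ₐ[K] MvPolynomial ((i : Fin n) × Fin (mfam i)) K).toRingHom (Jl l)) ∧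
    (∀ u : TensIdx rl 0 → MvPolynomial ((i : Fin n) × Fin (mfam i)) K,
        tensAug mfam rl gl u = 0 ↔ ∃ v, tensDiff mfam rl Ml 0 v = u) ∧
    -- it is minimal:
    (∀ (k : ℕ) (x : TensIdx rl (k + 1)) (y : TensIdx rl k),
        tensDiff mfam rl Ml k (Pi.single x 1) y ∈
          Ideal.span (Set.range (X : ((i : Fin n) × Fin (mfam i)) →
            MvPolynomial ((i : Fin n) × Fin (mfam i)) K))) ∧
    -- and `ℤ^N`-graded with respect to the product shifts:
    (∀ (k : ℕ) (x : TensIdx rl (k + 1)) (y : TensIdx rl k),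
        IsHomogEntry K (fun v => bl v.1 (y.1.1 v.1) (y.2 v.1) v.2)
          (fun v => bl v.1 (x.1.1 v.1) (x.2 v.1) v.2)
          (tensDiff mfam rl Ml k (Pi.single x 1) y)) := by
  refine ⟨fun k u => ?_, fun k u hu => ?_, fun t => ?_, fun u => ⟨fun hu => ?_, ?_⟩,
    fun k x y => tensDiff_single_mem hmin k _ y, isHomogEntry_tensDiff_single hhom⟩
  · obtain ⟨w, rfl, -⟩ := exists_degreePart_eq u
    rw [← degreePart_tensorTotalDiff, ← degreePart_tensorTotalDiff,
      tensorTotalDiff_tensorTotalDiff hexact, map_zero]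
  · obtain ⟨w, rfl, hw⟩ := exists_degreePart_eq u
    refine exists_tensDiff_eq hexact haugker (fun j => ?_) ?_
    · rcases eq_or_ne j k with rfl | hj
      · exact hu
      · rw [hw _ (by omega), tensDiff_zero]
    · rw [hw 0 (by omega)]
      simp [tensAug]
  · simp only [← hspan]
    exact exists_tensAug_eq_iff t
  · obtain ⟨w, rfl, hw⟩ := exists_degreePart_eq u
    exact exists_tensDiff_eq hexact haugker
      (fun j => by rw [hw _ (by omega), tensDiff_zero]) hu
  · rintro ⟨v, rfl⟩
    obtain ⟨w, rfl, -⟩ := exists_degreePart_eq v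
    rw [← degreePart_tensorTotalDiff, ← tensorEquivPoly_tensorTotalAug,
      tensorTotalAug_tensorTotalDiff haugker, map_zero]
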